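/- arXiv:2410.19372 — 3 statements merged into one kernel-verified Lean document; each statement's English description precedes it below -/
import Mathlib

section
/- Let F_1, …, F_n : ℝ^m → ℝ be differentiable convex functions and x ∈ ℝ^m. Suppose there is a nonempty set S ⊆ {1,…,n} and weights λ_i > 0 for i ∈ S with ∑_{i∈S} λ_i = 1 such that ∇F_i(x) ≠ 0 for every i ∈ S, ∑_{i∈S} λ_i ∇F_i(x) = 0, and ∇F_j(x) = 0 for every j ∉ S. Then x is Pareto optimal, i.e. there is no y ∈ ℝ^m with F_i(y) ≤ F_i(x) for all i and F_j(y) < F_j(x) for some j. -/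
open RealInnerProductSpace

/-- The first-order (subgradient) inequality for a differentiable convex function. -/
theorem ConvexOn.add_inner_gradient_le {E : Type*} [NormedAddCommGroup E]
    [InnerProductSpace ℝ E] [CompleteSpace E] {f : E → ℝ} {s : Set E} {x y : E}
    (hf : ConvexOn ℝ s f) (hx : x ∈ s) (hy : y ∈ s) (hd : DifferentiableAt ℝ f x) :
    f x + ⟪gradient f x, y - x⟫ ≤ f y := by
  have hline : ConvexOn ℝ (AffineMap.lineMap x y ⁻¹' s) (f ∘ AffineMap.lineMap (k := ℝ) x y) :=
    hf.comp_affineMap _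
  have hderiv : HasDerivAt (f ∘ AffineMap.lineMap (k := ℝ) x y) ⟪gradient f x, y - x⟫ 0 := by
    have hgrad : HasFDerivAt f (InnerProductSpace.toDual ℝ E (gradient f x))
        (AffineMap.lineMap x y (0 : ℝ)) := by
      simpa using hd.hasGradientAt.hasFDerivAt
    simpa using hgrad.comp_hasDerivAt (0 : ℝ) AffineMap.hasDerivAt_lineMap
  have hslope := hline.le_slope_of_hasDerivAt (x := 0) (y := 1) (by simpa using hx)
    (by simpa using hy) one_pos hderiv
  simp only [slope_def_field, Function.comp_apply, AffineMap.lineMap_apply_zero,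
    AffineMap.lineMap_apply_one, sub_zero, div_one] at hslope
  linarith

/-- Lemma 2 of the paper. If the gradients of convex differentiable
objectives admit a strictly positive convex combination, over a nonempty subset `S` of the
objectives whose gradients are all nonzero, summing to zero, while all objectives outside `S`
have zero gradient, then the point is (strongly) Pareto optimal. -/
theorem zero_convex_combination_of_nonzero_gradients_implies_pareto
    {m n : ℕ} (F : Fin n → EuclideanSpace ℝ (Fin m) → ℝ)
    (hdiff : ∀ i, Differentiable ℝ (F i))
    (hconv : ∀ i, ConvexOn ℝ Set.univ (F i))
    (x : EuclideanSpace ℝ (Fin m))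
    (S : Finset (Fin n)) (hS : S.Nonempty)
    (lam : Fin n → ℝ)
    (hpos : ∀ i ∈ S, 0 < lam i)
    (hsum : ∑ i ∈ S, lam i = 1)
    (hnonzero : ∀ i ∈ S, gradient (F i) x ≠ 0)
    (hcomb : ∑ i ∈ S, lam i • gradient (F i) x = 0)
    (hzero : ∀ j ∉ S, gradient (F j) x = 0) :
    ¬ ∃ y : EuclideanSpace ℝ (Fin m),
        (∀ i, F i y ≤ F i x) ∧ (∃ j, F j y < F j x) := by
  rintro ⟨y, hle, j, hlt⟩
  have hfirst : ∀ i, F i x + ⟪gradient (F i) x, y - x⟫ ≤ F i y := fun i =>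
    (hconv i).add_inner_gradient_le (Set.mem_univ x) (Set.mem_univ y) (hdiff i x)
  by_cases hj : j ∈ S
  · have hsum_lt : ∑ i ∈ S, lam i * F i y < ∑ i ∈ S, lam i * F i x :=
      Finset.sum_lt_sum (fun i hi => mul_le_mul_of_nonneg_left (hle i) (hpos i hi).le)
        ⟨j, hj, mul_lt_mul_of_pos_left hlt (hpos j hj)⟩
    have hsum_le : ∑ i ∈ S, lam i * (F i x + ⟪gradient (F i) x, y - x⟫) ≤
        ∑ i ∈ S, lam i * F i y :=
      Finset.sum_le_sum fun i hi => mul_le_mul_of_nonneg_left (hfirst i) (hpos i hi).le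
    have hinner : ∑ i ∈ S, lam i * ⟪gradient (F i) x, y - x⟫ = 0 := by
      simpa [sum_inner, real_inner_smul_left] using congrArg (fun v => ⟪v, y - x⟫) hcomb
    simp only [mul_add, Finset.sum_add_distrib, hinner] at hsum_le
    linarith
  · have hineq := hfirst j
    rw [hzero j hj, inner_zero_left] at hineq
    linarith
end

section
/- Let L > 0, let F_1, F_2 : ℝ^m → ℝ be L-smooth, let x ∈ ℝ^m, let S ⊆ {1,2} be nonempty, and let d ∈ ℝ^m be a vector with ⟨∇F_i(x), d⟩ ≥ ‖d‖² for every i ∈ S. If d ≠ 0, set t = max( (|S|·‖d‖² + ∑_{i∉S} ⟨∇F_i(x), d⟩) / (2L‖d‖²), 0 ); if d = 0 set t = 0. Then (F_1 + F_2)(x − t·d) ≤ (F_1 + F_2)(x). -/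
open RealInnerProductSpace

/-- The descent inequality for a function whose gradient is `L`-Lipschitz. -/
theorem le_add_inner_gradient_add_of_gradient_lipschitz
    {E : Type*} [NormedAddCommGroup E] [InnerProductSpace ℝ E] [CompleteSpace E]
    {f : E → ℝ} {L : ℝ} (hf : Differentiable ℝ f)
    (hL : ∀ x y, ‖gradient f x - gradient f y‖ ≤ L * ‖x - y‖) (x v : E) :
    f (x + v) ≤ f x + ⟪gradient f x, v⟫ + L / 2 * ‖v‖ ^ 2 := by
  have hderiv : ∀ s : ℝ, HasDerivAt
      (fun s : ℝ => f (x + s • v) - s * ⟪gradient f x, v⟫ - L / 2 * ‖v‖ ^ 2 * s ^ 2)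
      (⟪gradient f (x + s • v), v⟫ - ⟪gradient f x, v⟫ - L * ‖v‖ ^ 2 * s) s := by
    intro s
    have hline : HasDerivAt (fun s : ℝ => x + s • v) v s := by
      simpa using ((hasDerivAt_id s).smul_const v).const_add x
    have hcomp : HasDerivAt (fun s : ℝ => f (x + s • v)) ⟪gradient f (x + s • v), v⟫ s := by
      exact (hf (x + s • v)).hasGradientAt.hasFDerivAt.comp_hasDerivAt s hline
    refine ((hcomp.sub ((hasDerivAt_id s).mul_const ⟪gradient f x, v⟫)).sub
      ((hasDerivAt_pow 2 s).const_mul (L / 2 * ‖v‖ ^ 2))).congr_deriv ?_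
    push_cast
    ring
  have hanti := antitoneOn_of_hasDerivWithinAt_nonpos (convex_Icc (0 : ℝ) 1)
    (fun s _ => (hderiv s).continuousAt.continuousWithinAt)
    (fun s _ => (hderiv s).hasDerivWithinAt) (fun s hs => by
      have hs0 : 0 ≤ s := (interior_subset hs).1
      have hle : ⟪gradient f (x + s • v) - gradient f x, v⟫ ≤ L * ‖v‖ ^ 2 * s :=
        calc ⟪gradient f (x + s • v) - gradient f x, v⟫
            ≤ ‖gradient f (x + s • v) - gradient f x‖ * ‖v‖ := real_inner_le_norm _ _
          _ ≤ L * ‖x + s • v - x‖ * ‖v‖ := by gcongr; exact hL _ _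
          _ = L * ‖v‖ ^ 2 * s := by
            rw [add_sub_cancel_left, norm_smul, Real.norm_of_nonneg hs0]
            ring
      rw [inner_sub_left] at hle
      linarith)
  have h01 := hanti (Set.left_mem_Icc.2 zero_le_one) (Set.right_mem_Icc.2 zero_le_one) zero_le_one
  simp only [one_smul, zero_smul, add_zero] at h01
  linarith

/-- one-step monotonicity of MGDA++ for two objectives.  If `F₁, F₂` are
`L`-smooth, `S ⊆ {1,2}` is nonempty, and `d` satisfies `⟪∇Fᵢ(x), d⟫ ≥ ‖d‖²` for every
`i ∈ S`, then with the prescribed step size `t` the sum `F₁ + F₂` does not increase after the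
update `x ↦ x − t·d`. -/
theorem mgda_plus_plus_step_monotone
    {m : ℕ} (L : ℝ) (hL : 0 < L)
    (F : Fin 2 → EuclideanSpace ℝ (Fin m) → ℝ)
    (hdiff : ∀ i, Differentiable ℝ (F i))
    (hsmooth : ∀ i, ∀ x y : EuclideanSpace ℝ (Fin m),
      ‖gradient (F i) x - gradient (F i) y‖ ≤ L * ‖x - y‖)
    (x : EuclideanSpace ℝ (Fin m))
    (S : Finset (Fin 2)) (hS : S.Nonempty)
    (d : EuclideanSpace ℝ (Fin m))
    (hdesc : ∀ i ∈ S, ‖d‖ ^ 2 ≤ ⟪gradient (F i) x, d⟫)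
    (t : ℝ)
    (ht_ne : d ≠ 0 → t =
      max (((S.card : ℝ) * ‖d‖ ^ 2 + ∑ i ∈ Sᶜ, ⟪gradient (F i) x, d⟫) / (2 * L * ‖d‖ ^ 2)) 0)
    (ht_eq : d = 0 → t = 0) :
    F 0 (x - t • d) + F 1 (x - t • d) ≤ F 0 x + F 1 x := by
  rcases eq_or_ne d 0 with rfl | hd
  · simp
  have hdescent : ∀ i,
      F i (x - t • d) ≤ F i x - t * ⟪gradient (F i) x, d⟫ + L / 2 * (t ^ 2 * ‖d‖ ^ 2) := by
    intro i
    have h := le_add_inner_gradient_add_of_gradient_lipschitz (hdiff i) (hsmooth i) x (-(t • d))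
    rwa [← sub_eq_add_neg, inner_neg_right, real_inner_smul_right, norm_neg, norm_smul, mul_pow,
      Real.norm_eq_abs, sq_abs, ← sub_eq_add_neg] at h
  have hsum : (S.card : ℝ) * ‖d‖ ^ 2 + ∑ i ∈ Sᶜ, ⟪gradient (F i) x, d⟫
      ≤ ⟪gradient (F 0) x, d⟫ + ⟪gradient (F 1) x, d⟫ := by
    rw [← Fin.sum_univ_two (fun i => ⟪gradient (F i) x, d⟫), ← Finset.sum_add_sum_compl S,
      ← nsmul_eq_mul]
    gcongr
    exact Finset.card_nsmul_le_sum _ _ _ hdesc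
  have ht := ht_ne hd
  set A := (S.card : ℝ) * ‖d‖ ^ 2 + ∑ i ∈ Sᶜ, ⟪gradient (F i) x, d⟫
  have hpos : 0 < 2 * L * ‖d‖ ^ 2 := by positivity
  have ht0 : 0 ≤ t := ht ▸ le_max_right _ _
  have hstep : t * (t * (2 * L * ‖d‖ ^ 2)) = t * A := by
    rcases max_choice (A / (2 * L * ‖d‖ ^ 2)) 0 with h | h <;> rw [h] at ht
    · rw [ht, div_mul_cancel₀ _ hpos.ne']
    · simp [ht]
  have hmul := mul_le_mul_of_nonneg_left hsum ht0
  have hnonneg : 0 ≤ t * (t * (2 * L * ‖d‖ ^ 2)) := by positivity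
  linarith [hdescent 0, hdescent 1]
end

section
/- Let g_1, …, g_n ∈ ℝ^m. Let λ* be a minimizer over the probability simplex {λ ∈ ℝ^n : λ_i ≥ 0, ∑_i λ_i = 1} of ‖∑_i λ_i g_i‖², and set d* = −∑_i λ*_i g_i. Then d* minimizes the function d ↦ max_{i ∈ {1,…,n}} ⟨g_i, d⟩ + (1/2)‖d‖² over ℝ^m, and the optimal values are related by min_{d ∈ ℝ^m} ( max_i ⟨g_i, d⟩ + (1/2)‖d‖² ) = −(1/2) min_{λ ∈ simplex} ‖∑_i λ_i g_i‖². -/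
open RealInnerProductSpace

section

variable {ι E : Type*} [Fintype ι] [NormedAddCommGroup E] [InnerProductSpace ℝ E]

/-- If `‖w‖² ≤ ‖w + t • v‖²` for all `t ∈ [0, 1]`, then `v` makes a nonobtuse angle with `w`. -/
theorem inner_nonneg_of_norm_sq_le_norm_add_smul_sq {w v : E}
    (h : ∀ t : ℝ, 0 ≤ t → t ≤ 1 → ‖w‖ ^ 2 ≤ ‖w + t • v‖ ^ 2) : 0 ≤ ⟪w, v⟫ := by
  by_contra! ha
  have hb : 0 ≤ ‖v‖ ^ 2 := sq_nonneg _
  have hpos : 0 < ‖v‖ ^ 2 - ⟪w, v⟫ := by linarith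
  set t := -⟪w, v⟫ / (‖v‖ ^ 2 - ⟪w, v⟫) with ht
  have ht0 : 0 < t := div_pos (by linarith) hpos
  have ht1 : t ≤ 1 := (div_le_one hpos).2 (by linarith)
  have hmul : t * (‖v‖ ^ 2 - ⟪w, v⟫) = -⟪w, v⟫ := div_mul_cancel₀ _ hpos.ne'
  have key := h t ht0.le ht1
  rw [norm_add_sq_real, real_inner_smul_right, norm_smul, mul_pow, Real.norm_eq_abs, sq_abs] at key
  have hneg : 2 * ⟪w, v⟫ + t * ‖v‖ ^ 2 < 0 := by nlinarith
  nlinarith [mul_neg_of_pos_of_neg ht0 hneg]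

/-- First-order optimality for the minimum-norm convex combination. -/
theorem norm_sq_le_inner_of_forall_norm_sq_le (g : ι → E) (l : ι → ℝ)
    (hl : ∀ i, 0 ≤ l i) (hsum : ∑ i, l i = 1)
    (hopt : ∀ k : ι → ℝ, (∀ i, 0 ≤ k i) → ∑ i, k i = 1 →
      ‖∑ i, l i • g i‖ ^ 2 ≤ ‖∑ i, k i • g i‖ ^ 2) (j : ι) :
    ‖∑ i, l i • g i‖ ^ 2 ≤ ⟪g j, ∑ i, l i • g i⟫ := by
  classical
  have h := inner_nonneg_of_norm_sq_le_norm_add_smul_sq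
    (w := ∑ i, l i • g i) (v := g j - ∑ i, l i • g i) fun t ht0 ht1 => by
      have hk := hopt (fun i => (1 - t) * l i + t * Pi.single (M := fun _ => ℝ) j 1 i)
        (fun i => add_nonneg (mul_nonneg (by linarith) (hl i))
          (mul_nonneg ht0 (by by_cases hij : i = j <;> simp [hij])))
        (by simp [Finset.sum_add_distrib, ← Finset.mul_sum, hsum])
      convert hk using 3
      simp only [add_smul, mul_smul, Finset.sum_add_distrib, ← Finset.smul_sum]
      simp only [Pi.single_apply, ite_smul, one_smul, zero_smul, Finset.sum_ite_eq',
        Finset.mem_univ, if_true]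
      module
  rw [inner_sub_right, real_inner_self_eq_norm_sq, real_inner_comm] at h
  linarith

/-- The maximum of `⟪g i, d⟫` dominates its convex combinations. -/
theorem inner_sum_smul_le_iSup (g : ι → E) (l : ι → ℝ)
    (hl : ∀ i, 0 ≤ l i) (hsum : ∑ i, l i = 1) (d : E) :
    ⟪∑ i, l i • g i, d⟫ ≤ ⨆ i, ⟪g i, d⟫ := by
  calc ⟪∑ i, l i • g i, d⟫ = ∑ i, l i * ⟪g i, d⟫ := by
        simp only [sum_inner, real_inner_smul_left]
    _ ≤ ∑ i, l i * ⨆ j, ⟪g j, d⟫ := Finset.sum_le_sum fun i _ =>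
        mul_le_mul_of_nonneg_left
          (le_ciSup (f := fun j => ⟪g j, d⟫) (Set.finite_range _).bddAbove i) (hl i)
    _ = ⨆ i, ⟪g i, d⟫ := by rw [← Finset.sum_mul, hsum, one_mul]

end

/-- duality between the steepest common descent problem and the MGDA
min-norm problem.  If `λ*` minimizes `‖∑ᵢ λᵢ gᵢ‖²` over the probability simplex and
`d* = −∑ᵢ λ*ᵢ gᵢ`, then `d*` minimizes `d ↦ maxᵢ ⟪gᵢ, d⟫ + (1/2)‖d‖²` and the optimal values
satisfy `min_d (maxᵢ ⟪gᵢ, d⟫ + (1/2)‖d‖²) = −(1/2)·min_λ ‖∑ᵢ λᵢ gᵢ‖²`. -/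
theorem mgda_duality
    {m n : ℕ} (g : Fin n → EuclideanSpace ℝ (Fin m))
    (lamstar : Fin n → ℝ)
    (hnonneg : ∀ i, 0 ≤ lamstar i) (hsum : ∑ i, lamstar i = 1)
    (hopt : ∀ lam : Fin n → ℝ, (∀ i, 0 ≤ lam i) → ∑ i, lam i = 1 →
      ‖∑ i, lamstar i • g i‖ ^ 2 ≤ ‖∑ i, lam i • g i‖ ^ 2)
    (dstar : EuclideanSpace ℝ (Fin m))
    (hdstar : dstar = -∑ i, lamstar i • g i) :
    (∀ d : EuclideanSpace ℝ (Fin m),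
        (⨆ i, ⟪g i, dstar⟫) + (1 / 2) * ‖dstar‖ ^ 2 ≤ (⨆ i, ⟪g i, d⟫) + (1 / 2) * ‖d‖ ^ 2) ∧
    (⨆ i, ⟪g i, dstar⟫) + (1 / 2) * ‖dstar‖ ^ 2 = -(1 / 2) * ‖∑ i, lamstar i • g i‖ ^ 2 := by
  have hne : Nonempty (Fin n) := by
    by_contra h
    rw [not_nonempty_iff] at h
    simp at hsum
  have hlower := inner_sum_smul_le_iSup g lamstar hnonneg hsum
  have hfirst := norm_sq_le_inner_of_forall_norm_sq_le g lamstar hnonneg hsum hopt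
  subst hdstar
  set w := ∑ i, lamstar i • g i
  have hval : (⨆ i, ⟪g i, -w⟫) + (1 / 2) * ‖-w‖ ^ 2 = -(1 / 2) * ‖w‖ ^ 2 := by
    have hle : (⨆ i, ⟪g i, -w⟫) ≤ -‖w‖ ^ 2 := ciSup_le fun i => by
      rw [inner_neg_right]
      linarith [hfirst i]
    have hge := hlower (-w)
    rw [inner_neg_right, real_inner_self_eq_norm_sq] at hge
    rw [norm_neg]
    linarith
  refine ⟨fun d => ?_, hval⟩
  rw [hval]
  have hsq := sq_nonneg ‖w + d‖
  rw [norm_add_sq_real] at hsq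
  linarith [hlower d]
end
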